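/- Let n be a positive integer and let x be a complex number which is not an integer. Define U_n(x) = 2[(n+n²)(n+n²−x) + (1−n−n²)x² + x³ − x⁴]/((n+n²)(n+n²−x)x), V_n(x) = 2[n³(1+n)(1+n+x) − n²(2+n)x² − (1−2n−n²)x³ − (1+n)x⁴ + x⁵]/((n+n²)(n+n²−x)(n−x)x), and W_n(x) = 2[2n²(1+n)² − n²(5+3n)x − 2(1−3n−2n²)x² − 3(1+n)x³ + 2x⁴]/((1+n)(n+n²−x)(n−x)²x). Then Σ_{k=0}^{n} (−1)^k C(n,k) · C(n+k,k)/C(x+k,k) · k² · H_k^{⟨2⟩}(x) = (−1)^n · ((n+n²)(n+n²−x)/(2(1−x)(2−x))) · (C(−x+n,n)/C(x+n,n)) · { H_n^{⟨2⟩}(x) − H_n^{⟨2⟩}(−x) + [H_n(x) − H_n(−x) − 2H_{n+1}((x−n−2)/2) + U_n(x)] · [H_n(x) − H_n(−x)] + H_n((x−n)/2) · [H_n((x−n)/2) − V_n(x)] + W_n(x) }. -/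

import Mathlib

open Finset

/-- Generalized harmonic number `H_n(x) = ∑_{k=1}^n 1/(x+k)`. -/
noncomputable def genH (n : ℕ) (x : ℂ) : ℂ := ∑ k ∈ Finset.range n, 1 / (x + (k + 1))

/-- Generalized second-order harmonic number `H_n^{⟨2⟩}(x) = ∑_{k=1}^n 1/(x+k)^2`. -/
noncomputable def genH2 (n : ℕ) (x : ℂ) : ℂ := ∑ k ∈ Finset.range n, 1 / (x + (k + 1)) ^ 2

/-- Generalized binomial coefficient `C(z,m) = (∏_{j=0}^{m-1} (z-j))/m!`. -/
noncomputable def cbinom (z : ℂ) (m : ℕ) : ℂ := (∏ j ∈ Finset.range m, (z - j)) / (m.factorial : ℂ)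

/-- `U_n(x)` from Theorem 2.3 of the paper. -/
noncomputable def Ufun (n : ℕ) (x : ℂ) : ℂ :=
  2 * (((n : ℂ) + (n : ℂ) ^ 2) * ((n : ℂ) + (n : ℂ) ^ 2 - x) + (1 - (n : ℂ) - (n : ℂ) ^ 2) * x ^ 2
        + x ^ 3 - x ^ 4)
    / (((n : ℂ) + (n : ℂ) ^ 2) * ((n : ℂ) + (n : ℂ) ^ 2 - x) * x)

/-- `V_n(x)` from Theorem 2.3 of the paper. -/
noncomputable def Vfun (n : ℕ) (x : ℂ) : ℂ :=
  2 * ((n : ℂ) ^ 3 * (1 + (n : ℂ)) * (1 + (n : ℂ) + x) - (n : ℂ) ^ 2 * (2 + (n : ℂ)) * x ^ 2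
        - (1 - 2 * (n : ℂ) - (n : ℂ) ^ 2) * x ^ 3 - (1 + (n : ℂ)) * x ^ 4 + x ^ 5)
    / (((n : ℂ) + (n : ℂ) ^ 2) * ((n : ℂ) + (n : ℂ) ^ 2 - x) * ((n : ℂ) - x) * x)

/-- `W_n(x)` from Theorem 2.3 of the paper. -/
noncomputable def Wfun (n : ℕ) (x : ℂ) : ℂ :=
  2 * (2 * (n : ℂ) ^ 2 * (1 + (n : ℂ)) ^ 2 - (n : ℂ) ^ 2 * (5 + 3 * (n : ℂ)) * x
        - 2 * (1 - 3 * (n : ℂ) - 2 * (n : ℂ) ^ 2) * x ^ 2 - 3 * (1 + (n : ℂ)) * x ^ 3 + 2 * x ^ 4)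
    / ((1 + (n : ℂ)) * ((n : ℂ) + (n : ℂ) ^ 2 - x) * ((n : ℂ) - x) ^ 2 * x)

/-- The summand `(-1)^k C(n,k) C(n+k,k) / C(x+k,k)` without its weight. -/
noncomputable def legendreTerm (x : ℂ) (n k : ℕ) : ℂ :=
  (-1 : ℂ) ^ k * (n.choose k : ℂ) * (((n + k).choose k : ℂ) / cbinom (x + k) k)

/-- `∑ k, (-1)^k C(n,k) C(n+k,k) / C(x+k,k)`. -/
noncomputable def legendreSum (x : ℂ) (n : ℕ) : ℂ :=
  ∑ k ∈ range (n + 1), legendreTerm x n k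

/-- `∑ k, (-1)^k C(n,k) C(n+k,k) / C(x+k,k) / (x+k)`. -/
noncomputable def legendreInvSum (x : ℂ) (n : ℕ) : ℂ :=
  ∑ k ∈ range (n + 1), legendreTerm x n k / (x + k)

/-- `∑ k, (-1)^k C(n,k) C(n+k,k) / C(x+k,k) * H_k^{⟨2⟩}(x)`. -/
noncomputable def legendreHarmonicSum (x : ℂ) (n : ℕ) : ℂ :=
  ∑ k ∈ range (n + 1), legendreTerm x n k * genH2 k x

/-- The ratio of `legendreInvSum` to `legendreSum`, in closed form. -/
noncomputable def legendreInvRatio (x : ℂ) (n : ℕ) : ℂ :=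
  genH (n + 1) ((x - n - 2) / 2) - (genH n x - genH n (-x)) - 1 / x

section Auxiliary

variable {x : ℂ}

lemma add_natCast_ne_zero (hx : ∀ m : ℤ, x ≠ (m : ℂ)) (k : ℕ) : x + k ≠ 0 := by
  intro h
  exact hx (-k) (by push_cast; linear_combination h)

lemma sub_natCast_ne_zero (hx : ∀ m : ℤ, x ≠ (m : ℂ)) (k : ℕ) : x - k ≠ 0 := by
  intro h
  exact hx k (by push_cast; linear_combination h)

lemma cbinom_succ_mul (z : ℂ) (k : ℕ) :
    cbinom (z + (k + 1 : ℕ)) (k + 1) * (k + 1) = (z + k + 1) * cbinom (z + k) k := by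
  have hk : (k : ℂ) + 1 ≠ 0 := Nat.cast_add_one_ne_zero k
  have hf : (k.factorial : ℂ) ≠ 0 := by exact_mod_cast k.factorial_ne_zero
  have hprod : ∏ j ∈ range k, (z + (k + 1 : ℕ) - (j + 1 : ℕ)) = ∏ j ∈ range k, (z + k - j) :=
    prod_congr rfl fun j _ => by push_cast; ring
  unfold cbinom
  rw [prod_range_succ', hprod, Nat.factorial_succ]
  push_cast
  field_simp
  ring

lemma cbinom_add_ne_zero (hx : ∀ m : ℤ, x ≠ (m : ℂ)) (k : ℕ) : cbinom (x + k) k ≠ 0 := by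
  induction k with
  | zero => simp [cbinom]
  | succ k ih =>
    intro h
    have hmul := cbinom_succ_mul x k
    rw [h, zero_mul] at hmul
    have hk := add_natCast_ne_zero hx (k + 1)
    push_cast at hk
    rw [← add_assoc] at hk
    exact mul_ne_zero hk ih hmul.symm

lemma legendreTerm_zero (x : ℂ) (n : ℕ) : legendreTerm x n 0 = 1 := by
  simp [legendreTerm, cbinom]

lemma legendreTerm_self_succ (x : ℂ) (n : ℕ) : legendreTerm x n (n + 1) = 0 := by
  simp [legendreTerm]

lemma legendreTerm_succ_right (hx : ∀ m : ℤ, x ≠ (m : ℂ)) (n k : ℕ) :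
    legendreTerm x n (k + 1) * ((k + 1) * (x + k + 1))
      = -(((n : ℂ) - k) * (n + k + 1)) * legendreTerm x n k := by
  have hc := cbinom_add_ne_zero hx k
  have hrec := cbinom_succ_mul x k
  have h₁ : (n.choose (k + 1) : ℂ) * (k + 1) = n.choose k * (n - k) := by
    rcases le_or_gt k n with h | h
    · have := Nat.choose_succ_right_eq n k
      rw [← Nat.cast_sub h]
      exact_mod_cast this
    · rw [Nat.choose_eq_zero_of_lt h, Nat.choose_eq_zero_of_lt (by omega)]
      simp
  have h₂ : ((n + (k + 1)).choose (k + 1) : ℂ) * (k + 1) = (n + k + 1) * (n + k).choose k := by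
    have := Nat.add_one_mul_choose_eq (n + k) k
    exact_mod_cast this.symm
  have hk : (k : ℂ) + 1 ≠ 0 := Nat.cast_add_one_ne_zero k
  have hcd : cbinom (x + (k + 1 : ℕ)) (k + 1) = (x + k + 1) * cbinom (x + k) k / (k + 1) := by
    field_simp
    exact hrec
  have hxk := add_natCast_ne_zero hx (k + 1)
  push_cast at hxk
  rw [← add_assoc] at hxk
  unfold legendreTerm
  rw [hcd, pow_succ]
  field_simp
  linear_combination -(n.choose (k + 1) : ℂ) * (k + 1) * h₂
    - (n + k + 1) * (n + k).choose k * h₁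

lemma legendreTerm_succ_left (x : ℂ) (n k : ℕ) :
    legendreTerm x (n + 1) k * ((n : ℂ) + 1 - k) = legendreTerm x n k * (n + 1 + k) := by
  have h₁ : ((n + 1).choose k : ℂ) * (n + 1 - k) = n.choose k * (n + 1) := by
    rcases le_or_gt k (n + 1) with h | h
    · have := Nat.choose_mul_succ_eq n k
      have hcast : (n : ℂ) + 1 - k = ((n + 1 - k : ℕ) : ℂ) := by
        rw [Nat.cast_sub h]; push_cast; ring
      rw [hcast]
      exact_mod_cast this.symm
    · rw [Nat.choose_eq_zero_of_lt h, Nat.choose_eq_zero_of_lt (by omega)]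
      simp
  have h₂ : ((n + 1 + k).choose k : ℂ) * (n + 1) = (n + k).choose k * (n + 1 + k) := by
    have := Nat.choose_mul_succ_eq (n + k) k
    rw [show n + k + 1 - k = n + 1 by omega, show n + k + 1 = n + 1 + k by omega] at this
    exact_mod_cast this.symm
  have hn : (n : ℂ) + 1 ≠ 0 := Nat.cast_add_one_ne_zero n
  unfold legendreTerm
  apply mul_right_cancel₀ hn
  linear_combination (-1 : ℂ) ^ k * (cbinom (x + k) k)⁻¹ *
    (((n + 1 + k).choose k : ℂ) * (n + 1) * h₁ + n.choose k * (n + 1) * h₂)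

/-- Summation by parts. -/
lemma sum_range_sub_mul (G H : ℕ → ℂ) (M : ℕ) :
    ∑ k ∈ range M, (G (k + 1) - G k) * H k
      = G M * H M - G 0 * H 0 - ∑ k ∈ range M, G (k + 1) * (H (k + 1) - H k) := by
  induction M with
  | zero => simp
  | succ M ih => rw [sum_range_succ, sum_range_succ, ih]; ring

lemma sum_legendreTerm_mul_extend (x : ℂ) (n : ℕ) (f : ℕ → ℂ) :
    ∑ k ∈ range (n + 1), legendreTerm x n k * f k
      = ∑ k ∈ range (n + 2), legendreTerm x n k * f k := by
  rw [sum_range_succ _ (n + 1), legendreTerm_self_succ, zero_mul, add_zero]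

/-- The common factor of `legendreTerm x n k` and `legendreTerm x (n + 1) k`. -/
noncomputable def legendreCore (x : ℂ) (n k : ℕ) : ℂ := legendreTerm x (n + 1) k / (n + 1 + k)

lemma legendreTerm_succ_eq_core (x : ℂ) (n k : ℕ) :
    legendreTerm x (n + 1) k = (n + 1 + k) * legendreCore x n k := by
  have h : (n : ℂ) + 1 + k ≠ 0 := by exact_mod_cast (by omega : n + 1 + k ≠ 0)
  unfold legendreCore
  field_simp

lemma legendreTerm_eq_core (x : ℂ) (n k : ℕ) :
    legendreTerm x n k = (n + 1 - k) * legendreCore x n k := by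
  have h : (n : ℂ) + 1 + k ≠ 0 := by exact_mod_cast (by omega : n + 1 + k ≠ 0)
  have := legendreTerm_succ_left x n k
  rw [legendreTerm_succ_eq_core] at this
  apply mul_right_cancel₀ h
  linear_combination -this

lemma legendreCore_succ (hx : ∀ m : ℤ, x ≠ (m : ℂ)) (n k : ℕ) :
    legendreCore x n (k + 1) * ((k + 1) * (x + k + 1))
      = -((n + 1 - k) * (n + 1 + k)) * legendreCore x n k := by
  have h : (n : ℂ) + 2 + k ≠ 0 := by exact_mod_cast (by omega : n + 2 + k ≠ 0)
  have := legendreTerm_succ_right hx (n + 1) k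
  rw [legendreTerm_succ_eq_core, legendreTerm_succ_eq_core] at this
  push_cast at this
  apply mul_right_cancel₀ h
  linear_combination this

/-- The telescoping certificate for the recurrence of `legendreSum`, tested against a weight. -/
lemma legendreTerm_recurrence_weighted (hx : ∀ m : ℤ, x ≠ (m : ℂ)) (n : ℕ) (H : ℕ → ℂ) :
    (x + n + 1) * ∑ k ∈ range (n + 2), legendreTerm x (n + 1) k * H k
      - (x - n - 1) * ∑ k ∈ range (n + 1), legendreTerm x n k * H k
      = ∑ k ∈ range (n + 2),
          2 * (k + 1) * (x + k + 1) * legendreCore x n (k + 1) * (H (k + 1) - H k) := by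
  have hparts := sum_range_sub_mul (fun k => -2 * k * (x + k) * legendreCore x n k) H (n + 2)
  have hend : -2 * ((n + 2 : ℕ) : ℂ) * (x + (n + 2 : ℕ)) * legendreCore x n (n + 2) = 0 := by
    have := legendreCore_succ hx n (n + 1)
    push_cast at this ⊢
    linear_combination -2 * this
  rw [hend] at hparts
  rw [sum_legendreTerm_mul_extend x n, mul_sum, mul_sum, ← sum_sub_distrib]
  calc _ = ∑ k ∈ range (n + 2), (-2 * ((k + 1 : ℕ) : ℂ) * (x + (k + 1 : ℕ)) *
            legendreCore x n (k + 1) - -2 * k * (x + k) * legendreCore x n k) * H k := by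
        refine sum_congr rfl fun k _ => ?_
        have := legendreCore_succ hx n k
        rw [legendreTerm_succ_eq_core, legendreTerm_eq_core]
        push_cast
        linear_combination 2 * H k * this
    _ = _ := by
        rw [hparts, Nat.cast_zero, mul_zero, zero_mul, zero_mul, zero_mul, zero_mul, sub_zero,
          zero_sub, ← sum_neg_distrib]
        refine sum_congr rfl fun k _ => ?_
        push_cast
        ring

lemma legendreSum_succ (hx : ∀ m : ℤ, x ≠ (m : ℂ)) (n : ℕ) :
    (x + n + 1) * legendreSum x (n + 1) = (x - n - 1) * legendreSum x n := by
  have := legendreTerm_recurrence_weighted hx n fun _ => 1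
  simp only [sub_self, mul_zero, mul_one, sum_const_zero] at this
  exact sub_eq_zero.mp this

lemma legendreSum_add_succ (x : ℂ) (n : ℕ) :
    legendreSum x (n + 1) + legendreSum x n
      = 2 * (n + 1) * ∑ k ∈ range (n + 2), legendreCore x n k := by
  have hext := sum_legendreTerm_mul_extend x n fun _ => 1
  simp only [mul_one] at hext
  unfold legendreSum
  rw [hext, ← sum_add_distrib, mul_sum]
  refine sum_congr rfl fun k _ => ?_
  rw [legendreTerm_succ_eq_core, legendreTerm_eq_core]
  ring

lemma legendreInvSum_extend (x : ℂ) (n : ℕ) :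
    legendreInvSum x n = ∑ k ∈ range (n + 2), legendreTerm x n k / (x + k) := by
  simpa only [div_eq_mul_inv, legendreInvSum] using
    sum_legendreTerm_mul_extend x n fun k => (x + k)⁻¹

lemma legendreInvSum_succ (hx : ∀ m : ℤ, x ≠ (m : ℂ)) (n : ℕ) :
    (x + n + 1) * legendreInvSum x (n + 1) + (x - n - 1) * legendreInvSum x n
      = legendreSum x (n + 1) + legendreSum x n := by
  rw [legendreSum_add_succ, legendreInvSum_extend x n, legendreInvSum, mul_sum, mul_sum, mul_sum,
    ← sum_add_distrib]
  refine sum_congr rfl fun k _ => ?_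
  have := add_natCast_ne_zero hx k
  rw [legendreTerm_succ_eq_core, legendreTerm_eq_core]
  field_simp
  ring

lemma genH2_succ (x : ℂ) (k : ℕ) : genH2 (k + 1) x = genH2 k x + 1 / (x + k + 1) ^ 2 := by
  rw [genH2, sum_range_succ, ← genH2, add_assoc]

lemma genH_succ (x : ℂ) (k : ℕ) : genH (k + 1) x = genH k x + 1 / (x + k + 1) := by
  rw [genH, sum_range_succ, ← genH, add_assoc]

lemma legendreHarmonicSum_succ (hx : ∀ m : ℤ, x ≠ (m : ℂ)) (n : ℕ) :
    (n + 1) * ((x + n + 1) * legendreHarmonicSum x (n + 1) - (x - n - 1) * legendreHarmonicSum x n)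
      = legendreSum x (n + 1) + legendreSum x n
        - x * (legendreInvSum x (n + 1) + legendreInvSum x n) := by
  have hrec := legendreTerm_recurrence_weighted hx n fun k => genH2 k x
  have hlast : legendreCore x n (n + 2) = 0 := by
    rw [legendreCore, show n + 2 = n + 1 + 1 from rfl, legendreTerm_self_succ, zero_div]
  have hshift : ∑ k ∈ range (n + 2), 2 * (k + 1) * (x + k + 1) * legendreCore x n (k + 1) *
        (genH2 (k + 1) x - genH2 k x)
      = ∑ k ∈ range (n + 2), 2 * k * legendreCore x n k / (x + k) := by
    have h := sum_range_succ' (fun k : ℕ => 2 * (k : ℂ) * legendreCore x n k / (x + k)) (n + 2)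
    rw [sum_range_succ, hlast] at h
    simp only [mul_zero, zero_div, add_zero, Nat.cast_zero, zero_mul] at h
    rw [h]
    refine sum_congr rfl fun k _ => ?_
    have hk := add_natCast_ne_zero hx (k + 1)
    push_cast at hk ⊢
    rw [← add_assoc] at hk ⊢
    rw [genH2_succ]
    field_simp
    ring
  have hcore : legendreInvSum x (n + 1) + legendreInvSum x n
      = ∑ k ∈ range (n + 2), 2 * (n + 1) * legendreCore x n k / (x + k) := by
    rw [legendreInvSum_extend x n, legendreInvSum, ← sum_add_distrib]
    refine sum_congr rfl fun k _ => ?_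
    rw [legendreTerm_succ_eq_core, legendreTerm_eq_core]
    ring
  unfold legendreHarmonicSum
  rw [hrec, hshift, hcore, legendreSum_add_succ, mul_sum, mul_sum, mul_sum, ← sum_sub_distrib]
  refine sum_congr rfl fun k _ => ?_
  have := add_natCast_ne_zero hx k
  field_simp
  ring

lemma genH_half_succ_left (x : ℂ) (n : ℕ) :
    genH (n + 1) ((x - n - 2) / 2) = genH n ((x - n) / 2) + 2 / (x - n) := by
  unfold genH
  rw [sum_range_succ']
  congr 1
  · refine sum_congr rfl fun k _ => ?_
    push_cast
    ring
  · rw [← one_div_div (x - n) 2]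
    congr 1
    push_cast
    ring

lemma genH_half_add_two (x : ℂ) (n : ℕ) :
    genH (n + 3) ((x - (n + 2 : ℕ) - 2) / 2)
      = genH (n + 1) ((x - n - 2) / 2) + 2 / (x - n - 2) + 2 / (x + n + 2) := by
  rw [genH_half_succ_left x (n + 2), show n + 2 = n + 1 + 1 from rfl, genH_succ]
  have harg : (x - ((n + 1 + 1 : ℕ) : ℂ)) / 2 = (x - n - 2) / 2 := by push_cast; ring
  have hlast : 1 / ((x - n - 2) / 2 + ((n + 1 : ℕ) : ℂ) + 1) = 2 / (x + n + 2) := by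
    rw [← one_div_div (x + n + 2) 2]
    congr 1
    push_cast
    ring
  have hfirst : x - ((n + 1 + 1 : ℕ) : ℂ) = x - n - 2 := by push_cast; ring
  rw [harg, hlast, hfirst]
  ring

lemma genH_neg_succ (x : ℂ) (n : ℕ) :
    genH (n + 1) (-x) = genH n (-x) - 1 / (x - n - 1) := by
  rw [genH_succ, show -x + n + 1 = -(x - n - 1) by ring, div_neg, ← sub_eq_add_neg]

lemma genH2_neg_succ (x : ℂ) (n : ℕ) :
    genH2 (n + 1) (-x) = genH2 n (-x) + 1 / (x - n - 1) ^ 2 := by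
  rw [genH2_succ, show -x + n + 1 = -(x - n - 1) by ring, neg_sq]

lemma genH_half_add_succ (x : ℂ) (n : ℕ) :
    genH (n + 2) ((x - (n + 1 : ℕ) - 2) / 2) + genH (n + 1) ((x - n - 2) / 2)
      = 2 * (genH n x - genH n (-x)) + 2 / x + 2 / (x + n + 1) + 2 / (x - n - 1) := by
  induction n with
  | zero =>
    rw [genH_half_succ_left, genH_half_succ_left, show genH (0 + 1) _ = _ from genH_succ _ 0]
    simp only [genH, range_zero, sum_empty]
    rw [show (x - ((1 : ℕ) : ℂ)) / 2 + ((0 : ℕ) : ℂ) + 1 = (x + 1) / 2 by push_cast; ring,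
      one_div_div]
    push_cast
    ring
  | succ n ih =>
    rw [genH_half_add_two, genH_succ x, genH_neg_succ]
    push_cast at ih ⊢
    rw [show x + (n + 1 : ℂ) + 1 = x + n + 2 by ring, show x - (n + 1 : ℂ) - 1 = x - n - 2 by ring]
    linear_combination ih

lemma legendreInvRatio_add_succ (x : ℂ) (n : ℕ) :
    legendreInvRatio x (n + 1) + legendreInvRatio x n = 1 / (x + n + 1) + 1 / (x - n - 1) := by
  have := genH_half_add_succ x n
  unfold legendreInvRatio
  rw [genH_succ x, genH_neg_succ]
  linear_combination this

lemma legendreInvSum_eq (hx : ∀ m : ℤ, x ≠ (m : ℂ)) (n : ℕ) :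
    legendreInvSum x n = legendreSum x n * legendreInvRatio x n := by
  induction n with
  | zero =>
    simp only [legendreInvSum, legendreSum, legendreInvRatio, zero_add, sum_range_one,
      legendreTerm_zero, genH_half_succ_left x 0]
    simp only [genH, range_zero, sum_empty, Nat.cast_zero]
    ring
  | succ n ih =>
    have hp := add_natCast_ne_zero hx (n + 1)
    have hm := sub_natCast_ne_zero hx (n + 1)
    push_cast at hp hm
    rw [← add_assoc] at hp
    rw [← sub_sub] at hm
    have hS := legendreSum_succ hx n
    have hI := legendreInvSum_succ hx n
    have hR := legendreInvRatio_add_succ x n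
    rw [ih] at hI
    rw [← eq_sub_iff_add_eq] at hR
    rw [hR]
    have hS' : legendreSum x (n + 1) = (x - n - 1) * legendreSum x n / (x + n + 1) := by
      field_simp
      linear_combination hS
    rw [hS'] at hI ⊢
    apply mul_left_cancel₀ hp
    field_simp at hI ⊢
    linear_combination hI

lemma legendreHarmonicSum_eq (hx : ∀ m : ℤ, x ≠ (m : ℂ)) (n : ℕ) :
    legendreHarmonicSum x n = legendreSum x n *
      ((genH2 n x - genH2 n (-x) + legendreInvRatio x n ^ 2 - 1 / x ^ 2) / 2) := by
  induction n with
  | zero =>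
    simp only [legendreHarmonicSum, legendreInvRatio, zero_add, sum_range_one,
      genH_half_succ_left x 0]
    simp only [genH, genH2, range_zero, sum_empty, Nat.cast_zero]
    ring
  | succ n ih =>
    have hp := add_natCast_ne_zero hx (n + 1)
    have hm := sub_natCast_ne_zero hx (n + 1)
    have hn : (n : ℂ) + 1 ≠ 0 := Nat.cast_add_one_ne_zero n
    have hx0 : x ≠ 0 := by simpa using hx 0
    push_cast at hp hm
    rw [← add_assoc] at hp
    rw [← sub_sub] at hm
    have hA := legendreHarmonicSum_succ hx n
    have hS := legendreSum_succ hx n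
    have hR := legendreInvRatio_add_succ x n
    rw [← eq_sub_iff_add_eq] at hR
    have hS' : legendreSum x (n + 1) = (x - n - 1) * legendreSum x n / (x + n + 1) := by
      field_simp
      linear_combination hS
    rw [ih, legendreInvSum_eq hx, legendreInvSum_eq hx, hR, hS'] at hA
    rw [hR, genH2_succ, genH2_neg_succ, hS']
    apply mul_left_cancel₀ hp
    apply mul_left_cancel₀ hn
    rw [mul_sub, sub_eq_iff_eq_add] at hA
    rw [hA]
    field_simp
    ring

lemma legendreSum_eq (hx : ∀ m : ℤ, x ≠ (m : ℂ)) (n : ℕ) :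
    legendreSum x n = (-1) ^ n * (cbinom (-x + n) n / cbinom (x + n) n) := by
  induction n with
  | zero => simp [legendreSum, legendreTerm_zero, cbinom]
  | succ n ih =>
    have hp := add_natCast_ne_zero hx (n + 1)
    have hn : (n : ℂ) + 1 ≠ 0 := Nat.cast_add_one_ne_zero n
    push_cast at hp
    rw [← add_assoc] at hp
    have hS := legendreSum_succ hx n
    have hc := cbinom_add_ne_zero hx n
    have hq := cbinom_succ_mul x n
    have hq' := cbinom_succ_mul (-x) n
    rw [← eq_div_iff hn] at hq hq'
    rw [ih] at hS
    apply mul_left_cancel₀ hp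
    rw [hS, hq, hq', pow_succ]
    field_simp
    ring

/-- Reduction of a quadratic weight to the constant weight, tested against a factor `H`. -/
lemma sum_legendreTerm_sq_weighted (hx : ∀ m : ℤ, x ≠ (m : ℂ)) (n : ℕ) (α β : ℂ) (H : ℕ → ℂ) :
    ∑ k ∈ range (n + 1), (α * (k ^ 2 * (2 - x) + k * (1 - (n + n ^ 2)) - (n + n ^ 2))
        + β * (k * (1 - x) - (n + n ^ 2))) * legendreTerm x n k * H k
      = -∑ k ∈ range (n + 1), (α * (k + 1) + β) * (k + 1) * (x + k + 1) *
          legendreTerm x n (k + 1) * (H (k + 1) - H k) := by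
  have hparts := sum_range_sub_mul
    (fun k => (α * k + β) * k * (x + k) * legendreTerm x n k) H (n + 1)
  simp only [legendreTerm_self_succ, Nat.cast_zero, mul_zero, zero_mul, zero_sub,
    sub_zero] at hparts
  calc _ = ∑ k ∈ range (n + 1), ((α * (k + 1 : ℕ) + β) * (k + 1 : ℕ) * (x + (k + 1 : ℕ)) *
          legendreTerm x n (k + 1) - (α * k + β) * k * (x + k) * legendreTerm x n k) * H k := by
        refine sum_congr rfl fun k _ => ?_
        have := legendreTerm_succ_right hx n k
        push_cast
        linear_combination -(α * (k + 1) + β) * H k * this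
    _ = _ := by
        rw [hparts]
        push_cast
        simp only [add_assoc]

lemma sum_mul_legendreTerm (hx : ∀ m : ℤ, x ≠ (m : ℂ)) (n : ℕ) :
    (1 - x) * ∑ k ∈ range (n + 1), k * legendreTerm x n k = (n + n ^ 2) * legendreSum x n := by
  have h := sum_legendreTerm_sq_weighted hx n 0 1 fun _ => 1
  simp only [sub_self, mul_zero, sum_const_zero, neg_zero] at h
  rw [legendreSum, mul_sum, mul_sum, ← sub_eq_zero, ← sum_sub_distrib, ← h]
  refine sum_congr rfl fun k _ => ?_
  ring

lemma sum_sq_mul_legendreTerm_mul_genH2 (hx : ∀ m : ℤ, x ≠ (m : ℂ)) (n : ℕ) :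
    (1 - x) * (2 - x) * ∑ k ∈ range (n + 1), legendreTerm x n k * k ^ 2 * genH2 k x
      = (n + n ^ 2) * (n + n ^ 2 - x) * legendreHarmonicSum x n
        - (n + n ^ 2) * legendreSum x n
        + (1 - (n + n ^ 2) + x * (1 - x)) * (legendreSum x n - x * legendreInvSum x n) := by
  have h := sum_legendreTerm_sq_weighted hx n (1 - x) ((n + n ^ 2) - 1) fun k => genH2 k x
  have hshift : ∑ k ∈ range (n + 1), ((1 - x) * (k + 1) + ((n + n ^ 2) - 1)) * (k + 1) *
          (x + k + 1) * legendreTerm x n (k + 1) * (genH2 (k + 1) x - genH2 k x)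
      = ∑ k ∈ range (n + 1), ((1 - x) * k + ((n + n ^ 2) - 1)) * k *
          legendreTerm x n k / (x + k) := by
    have h := sum_range_succ' (fun k : ℕ => ((1 - x) * k + (((n : ℂ) + n ^ 2) - 1)) * k *
      legendreTerm x n k / (x + k)) (n + 1)
    rw [sum_range_succ, legendreTerm_self_succ] at h
    simp only [mul_zero, zero_div, add_zero, Nat.cast_zero, zero_mul] at h
    rw [h]
    refine sum_congr rfl fun k _ => ?_
    have hk := add_natCast_ne_zero hx (k + 1)
    push_cast at hk ⊢
    rw [← add_assoc] at hk ⊢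
    rw [genH2_succ]
    field_simp
    ring
  have hsplit : ∑ k ∈ range (n + 1), ((1 - x) * k + ((n + n ^ 2) - 1)) * k *
          legendreTerm x n k / (x + k)
      = (1 - x) * ∑ k ∈ range (n + 1), k * legendreTerm x n k
        - (1 - (n + n ^ 2) + x * (1 - x)) * (legendreSum x n - x * legendreInvSum x n) := by
    rw [legendreSum, legendreInvSum, mul_sum, mul_sum, ← sum_sub_distrib, mul_sum,
      ← sum_sub_distrib]
    refine sum_congr rfl fun k _ => ?_
    have := add_natCast_ne_zero hx k
    field_simp
    ring
  rw [hshift, hsplit, sum_mul_legendreTerm hx] at h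
  have hlhs : (1 - x) * (2 - x) * ∑ k ∈ range (n + 1), legendreTerm x n k * k ^ 2 * genH2 k x
      - (n + n ^ 2) * (n + n ^ 2 - x) * legendreHarmonicSum x n
      = ∑ k ∈ range (n + 1), ((1 - x) * (k ^ 2 * (2 - x) + k * (1 - (n + n ^ 2)) - (n + n ^ 2))
        + ((n + n ^ 2) - 1) * (k * (1 - x) - (n + n ^ 2))) * legendreTerm x n k * genH2 k x := by
    rw [legendreHarmonicSum, mul_sum, mul_sum, ← sum_sub_distrib]
    refine sum_congr rfl fun k _ => ?_
    ring
  linear_combination hlhs + h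

end Auxiliary

theorem stmt2 (n : ℕ) (hn : 0 < n) (x : ℂ) (hx : ∀ m : ℤ, x ≠ (m : ℂ)) :
    ∑ k ∈ Finset.range (n + 1),
      (-1 : ℂ) ^ k * (n.choose k : ℂ) * (((n + k).choose k : ℂ) / cbinom (x + k) k) *
        (k : ℂ) ^ 2 * genH2 k x
    = (-1 : ℂ) ^ n *
      (((n : ℂ) + (n : ℂ) ^ 2) * ((n : ℂ) + (n : ℂ) ^ 2 - x) / (2 * (1 - x) * (2 - x))) *
      (cbinom (-x + n) n / cbinom (x + n) n) *
      (genH2 n x - genH2 n (-x)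
        + (genH n x - genH n (-x) - 2 * genH (n + 1) ((x - n - 2) / 2) + Ufun n x) *
          (genH n x - genH n (-x))
        + genH n ((x - n) / 2) * (genH n ((x - n) / 2) - Vfun n x)
        + Wfun n x) := by
  have hx0 : x ≠ 0 := by simpa using hx 0
  have h1 : 1 - x ≠ 0 := fun h => hx 1 (by push_cast; linear_combination -h)
  have h2 : 2 - x ≠ 0 := fun h => hx 2 (by push_cast; linear_combination -h)
  have hnx : (n : ℂ) - x ≠ 0 := fun h => hx n (by push_cast; linear_combination -h)
  have hN : (n : ℂ) + n ^ 2 - x ≠ 0 := fun h => hx (n + n ^ 2) (by push_cast; linear_combination -h)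
  have hn0 : (n : ℂ) ≠ 0 := by exact_mod_cast hn.ne'
  have hn1 : 1 + (n : ℂ) ≠ 0 := by rw [add_comm]; exact Nat.cast_add_one_ne_zero n
  have hNn : (n : ℂ) + n ^ 2 = n * (1 + n) := by ring
  have hN' : (n : ℂ) * (1 + n) - x ≠ 0 := hNn ▸ hN
  have hsum := sum_sq_mul_legendreTerm_mul_genH2 hx n
  rw [legendreHarmonicSum_eq hx, legendreInvSum_eq hx] at hsum
  rw [mul_right_comm ((-1 : ℂ) ^ n), ← legendreSum_eq hx]
  change ∑ k ∈ range (n + 1), legendreTerm x n k * (k : ℂ) ^ 2 * genH2 k x = _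
  apply mul_left_cancel₀ (mul_ne_zero h1 h2)
  rw [hsum, legendreInvRatio, genH_half_succ_left, Ufun, Vfun, Wfun, hNn]
  generalize legendreSum x n = S
  generalize genH n ((x - n) / 2) = h
  generalize genH n x = a
  generalize genH n (-x) = b
  generalize genH2 n x = c
  generalize genH2 n (-x) = d
  rw [show x - (n : ℂ) = -(n - x) by ring]
  field_simp
  ring
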